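/- arXiv:2006.00516 — 2 statements merged into one kernel-verified Lean document; each statement's English description precedes it below -/
import Mathlib

section
/- Let n ≥ 2 and let p = (p_1,…,p_n) ∈ [0,1]^n with 0 ≤ p_1 ≤ p_2 ≤ … ≤ p_n ≤ 1. Then there exists a pairwise independent distribution θ with marginal vector p such that P_θ(∑_{i=1}^n c_i ≥ 1) = min( ∑_{i=1}^n p_i − p_n·(∑_{i=1}^{n−1} p_i), 1 ). Consequently, the maximum of P_θ(∑_{i=1}^n c_i ≥ 1) over all pairwise independent distributions θ with marginal vector p equals min( ∑_{i=1}^n p_i − p_n·(∑_{i=1}^{n−1} p_i), 1 ). -/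
open Finset

noncomputable section

/-- Probability that at least `k` of the `n` coordinates equal `1` under the pmf `θ` on `{0,1}^n`. -/
def probGE (n : ℕ) (θ : (Fin n → Bool) → ℝ) (k : ℕ) : ℝ :=
  ∑ c ∈ Finset.univ.filter
      (fun c : Fin n → Bool => k ≤ (Finset.univ.filter (fun i => c i = true)).card), θ c

/-- Probability that all `n` coordinates equal `1` under the pmf `θ` on `{0,1}^n`. -/
def probAll (n : ℕ) (θ : (Fin n → Bool) → ℝ) : ℝ :=
  ∑ c ∈ Finset.univ.filter (fun c : Fin n → Bool => ∀ i, c i = true), θ c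

/-- `θ` is a probability mass function on `{0,1}^n`. -/
def IsDist (n : ℕ) (θ : (Fin n → Bool) → ℝ) : Prop :=
  (∀ c, 0 ≤ θ c) ∧ (∑ c, θ c = 1)

/-- Univariate marginal probability `P_θ(c_i = 1)`. -/
def Marg (n : ℕ) (θ : (Fin n → Bool) → ℝ) (i : Fin n) : ℝ :=
  ∑ c ∈ Finset.univ.filter (fun c : Fin n → Bool => c i = true), θ c

/-- Bivariate probability `P_θ(c_i = 1, c_j = 1)`. -/
def Biv (n : ℕ) (θ : (Fin n → Bool) → ℝ) (i j : Fin n) : ℝ :=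
  ∑ c ∈ Finset.univ.filter (fun c : Fin n → Bool => c i = true ∧ c j = true), θ c

/-- `θ` is a pairwise independent distribution with marginal vector `p`. -/
def PairwiseIndep (n : ℕ) (p : Fin n → ℝ) (θ : (Fin n → Bool) → ℝ) : Prop :=
  IsDist n θ ∧ (∀ i, Marg n θ i = p i) ∧
    (∀ i j : Fin n, i < j → Biv n θ i j = p i * p j)

/-- Expectation of `f` under the weights `θ`. -/
def EE {n : ℕ} (θ : (Fin n → Bool) → ℝ) (f : (Fin n → Bool) → ℝ) : ℝ := ∑ c, θ c * f c

/-- 0/1 value of a coordinate. -/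
def xx {n : ℕ} (i : Fin n) (c : Fin n → Bool) : ℝ := if c i = true then 1 else 0

/-- Indicator of a nonzero vector. -/
def nz {n : ℕ} (c : Fin n → Bool) : ℝ := if ∃ i, c i = true then 1 else 0

/-- Pushforward of weights. -/
def push {n : ℕ} (g : (Fin n → Bool) → (Fin n → Bool)) (θ : (Fin n → Bool) → ℝ) :
    (Fin n → Bool) → ℝ := fun d => ∑ c, if g c = d then θ c else 0

/-- Point mass. -/
def dirac {n : ℕ} (x : Fin n → Bool) : (Fin n → Bool) → ℝ := fun c => if c = x then 1 else 0

/-- Unit vector. -/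
def unitv {n : ℕ} (i : Fin n) : Fin n → Bool := fun j => decide (j = i)

theorem EE_push {n : ℕ} (g : (Fin n → Bool) → (Fin n → Bool)) (θ f) :
    EE (push g θ) f = EE θ (fun c => f (g c)) := by
  unfold EE push
  simp only [Finset.sum_mul]
  rw [Finset.sum_comm]
  refine Finset.sum_congr rfl fun c _ => ?_
  simp [ite_mul]

theorem EE_dirac {n : ℕ} (x : Fin n → Bool) (f) : EE (dirac x) f = f x := by
  simp [EE, dirac]

theorem EE_add {n : ℕ} (θ η : (Fin n → Bool) → ℝ) (f) : EE (θ + η) f = EE θ f + EE η f := by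
  simp [EE, add_mul, Finset.sum_add_distrib]

theorem EE_smul {n : ℕ} (a : ℝ) (θ : (Fin n → Bool) → ℝ) (f) : EE (a • θ) f = a * EE θ f := by
  simp [EE, mul_assoc, Finset.mul_sum]

theorem EE_sum {n : ℕ} {ι : Type*} (s : Finset ι) (θ : ι → (Fin n → Bool) → ℝ) (f) :
    EE (∑ i ∈ s, θ i) f = ∑ i ∈ s, EE (θ i) f := by
  simp only [EE, Finset.sum_apply, Finset.sum_mul]
  rw [Finset.sum_comm]

theorem EE_mono {n : ℕ} {θ : (Fin n → Bool) → ℝ} (h : ∀ c, 0 ≤ θ c) {f g : (Fin n → Bool) → ℝ}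
    (hfg : ∀ c, f c ≤ g c) : EE θ f ≤ EE θ g :=
  Finset.sum_le_sum fun c _ => mul_le_mul_of_nonneg_left (hfg c) (h c)

theorem push_nonneg {n : ℕ} (g : (Fin n → Bool) → (Fin n → Bool)) {θ : (Fin n → Bool) → ℝ}
    (h : ∀ c, 0 ≤ θ c) (d) : 0 ≤ push g θ d := by
  refine Finset.sum_nonneg fun c _ => ?_
  split_ifs
  exacts [h c, le_rfl]

theorem dirac_nonneg {n : ℕ} (x c : Fin n → Bool) : 0 ≤ dirac x c := by
  unfold dirac; split_ifs <;> norm_num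

theorem probGE_eq {n : ℕ} (θ : (Fin n → Bool) → ℝ) : probGE n θ 1 = EE θ nz := by
  unfold probGE EE nz
  rw [Finset.sum_filter]
  refine Finset.sum_congr rfl fun c _ => ?_
  have : (1 ≤ (Finset.univ.filter (fun i => c i = true)).card) ↔ ∃ i, c i = true := by
    rw [Nat.succ_le_iff, Finset.card_pos]
    simp [Finset.Nonempty]
  simp [this]

theorem Marg_eq {n : ℕ} (θ : (Fin n → Bool) → ℝ) (i) : Marg n θ i = EE θ (xx i) := by
  unfold Marg EE xx
  rw [Finset.sum_filter]
  simp

theorem Biv_eq {n : ℕ} (θ : (Fin n → Bool) → ℝ) (i j) :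
    Biv n θ i j = EE θ (fun c => xx i c * xx j c) := by
  unfold Biv EE xx
  rw [Finset.sum_filter]
  refine Finset.sum_congr rfl fun c _ => ?_
  by_cases h1 : c i = true <;> by_cases h2 : c j = true <;> simp [h1, h2]

/-- Pairwise independence in expectation form. -/
def PI2 (n : ℕ) (p : Fin n → ℝ) (θ : (Fin n → Bool) → ℝ) : Prop :=
  (∀ c, 0 ≤ θ c) ∧ EE θ (fun _ => 1) = 1 ∧ (∀ i, EE θ (xx i) = p i) ∧
    ∀ i j, i ≠ j → EE θ (fun c => xx i c * xx j c) = p i * p j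

theorem PI2_iff {n : ℕ} (p : Fin n → ℝ) (θ) : PairwiseIndep n p θ ↔ PI2 n p θ := by
  unfold PairwiseIndep IsDist PI2
  simp only [Marg_eq, Biv_eq]
  constructor
  · rintro ⟨⟨h1, h2⟩, h3, h4⟩
    refine ⟨h1, by simpa [EE] using h2, h3, fun i j hij => ?_⟩
    rcases lt_or_gt_of_ne hij with h | h
    · exact h4 i j h
    · rw [mul_comm, ← h4 j i h]
      simp only [mul_comm]
  · rintro ⟨h1, h2, h3, h4⟩
    exact ⟨⟨h1, by simpa [EE] using h2⟩, h3, fun i j hij => h4 i j hij.ne⟩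

theorem xx_update_self {n : ℕ} (i : Fin n) (c) : xx i (Function.update c i true) = 1 := by
  simp [xx]

theorem xx_update_ne {n : ℕ} {i j : Fin n} (h : j ≠ i) (c) :
    xx j (Function.update c i true) = xx j c := by
  simp [xx, h]

theorem noise_one {n : ℕ} {p : Fin n → ℝ} {θ} (h : PI2 n p θ) (i : Fin n) (t : ℝ)
    (ht : p i ≤ t) (ht1 : t ≤ 1) :
    ∃ θ', PI2 n (Function.update p i t) θ' ∧ EE θ nz ≤ EE θ' nz := by
  obtain ⟨h1, h2, h3, h4⟩ := h
  obtain ⟨s, hs0, hs1, hs⟩ : ∃ s : ℝ, 0 ≤ s ∧ s ≤ 1 ∧ (1 - s) * p i + s = t := by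
    by_cases hp : p i = 1
    · exact ⟨0, by norm_num, by norm_num, by linarith⟩
    · have : 0 < 1 - p i := by
        have : p i < 1 := lt_of_le_of_ne (ht.trans ht1) hp
        linarith
      refine ⟨(t - p i) / (1 - p i), div_nonneg (by linarith) this.le, ?_, ?_⟩
      · rw [div_le_one this]; linarith
      · field_simp; ring
  set g : (Fin n → Bool) → (Fin n → Bool) := fun c => Function.update c i true with hg
  refine ⟨(1 - s) • θ + s • push g θ, ⟨?_, ?_, ?_, ?_⟩, ?_⟩
  · intro c
    have := h1 c
    have := push_nonneg g h1 c
    have : 0 ≤ 1 - s := by linarith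
    simp only [Pi.add_apply, Pi.smul_apply, smul_eq_mul]
    positivity
  · simp only [EE_add, EE_smul, EE_push, h2]; ring
  · intro j
    simp only [EE_add, EE_smul, EE_push, h3]
    by_cases hj : j = i
    · subst hj
      simp only [hg, xx_update_self, h2, Function.update_self]; linarith
    · simp only [hg, xx_update_ne hj]
      rw [show (fun c => xx j c) = xx j from rfl, h3, Function.update_of_ne hj]; ring
  · intro j k hjk
    simp only [EE_add, EE_smul, EE_push, h4 j k hjk]
    by_cases hj : j = i
    · subst hj
      simp only [hg, xx_update_self, xx_update_ne hjk.symm, one_mul, Function.update_self]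
      rw [show (fun c => xx k c) = xx k from rfl, h3, Function.update_of_ne hjk.symm, ← hs]; ring
    · by_cases hk : k = i
      · subst hk
        simp only [hg, xx_update_self, xx_update_ne hj, mul_one, Function.update_self]
        rw [show (fun c => xx j c) = xx j from rfl, h3, Function.update_of_ne hj, ← hs]; ring
      · simp only [hg, xx_update_ne hj, xx_update_ne hk]
        rw [h4 j k hjk, Function.update_of_ne hj, Function.update_of_ne hk]; ring
  · have : EE θ nz ≤ EE (push g θ) nz := by
      rw [EE_push]
      refine EE_mono h1 fun c => ?_
      have : nz (g c) = 1 := by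
        unfold nz; rw [if_pos]; exact ⟨i, by simp [hg]⟩
      rw [this]; unfold nz; split_ifs <;> norm_num
    rw [EE_add, EE_smul, EE_smul]
    nlinarith

theorem noise {n : ℕ} {p p' : Fin n → ℝ} {θ} (h : PI2 n p θ) (hpp : ∀ i, p i ≤ p' i)
    (h1 : ∀ i, p' i ≤ 1) : ∃ θ', PI2 n p' θ' ∧ EE θ nz ≤ EE θ' nz := by
  have key : ∀ T : Finset (Fin n), ∃ θ', PI2 n (fun i => if i ∈ T then p' i else p i) θ' ∧
      EE θ nz ≤ EE θ' nz := by
    intro T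
    induction T using Finset.induction_on with
    | empty => exact ⟨θ, by simpa using h, le_rfl⟩
    | insert a s ha ih =>
      obtain ⟨η, hη, hle⟩ := ih
      obtain ⟨η', hη', hle'⟩ := noise_one hη a (p' a) (by simpa [ha] using hpp a) (h1 a)
      refine ⟨η', ?_, hle.trans hle'⟩
      convert hη' using 1
      funext i
      by_cases hi : i = a
      · subst hi; simp
      · simp [hi]
  simpa using key Finset.univ

theorem exists_indep {n : ℕ} {p : Fin n → ℝ} (h0 : ∀ i, 0 ≤ p i) (h1 : ∀ i, p i ≤ 1) :
    ∃ θ, PI2 n p θ := by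
  have : PI2 n (fun _ => 0) (dirac (fun _ : Fin n => false)) := by
    refine ⟨dirac_nonneg _, ?_, ?_, ?_⟩ <;> simp [EE_dirac, xx]
  obtain ⟨θ, h, -⟩ := noise this h0 h1
  exact ⟨θ, h⟩

theorem xx_unitv {n : ℕ} (i j : Fin n) : xx i (unitv j) = if i = j then 1 else 0 := by
  simp [xx, unitv]

theorem nz_unitv {n : ℕ} (j : Fin n) : nz (unitv j) = 1 := by
  unfold nz; rw [if_pos]; exact ⟨j, by simp [unitv]⟩

theorem base {n : ℕ} {r : Fin n → ℝ} (l : Fin n) (h0 : ∀ i, 0 ≤ r i) (hl : ∀ i, r i ≤ r l)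
    (h1 : r l ≤ 1) (hS : ∑ i ∈ Finset.univ.erase l, r i ≤ 1) :
    ∃ θ, PI2 n r θ ∧ r l + (1 - r l) * ∑ i ∈ Finset.univ.erase l, r i ≤ EE θ nz := by
  set q := r l with hq
  set S := ∑ i ∈ Finset.univ.erase l, r i with hSdef
  have hq0 : 0 ≤ q := h0 l
  have hdiv : ∀ i, q * (r i / q) = r i := by
    intro i
    by_cases h : q = 0
    · have : r i = 0 := le_antisymm (h ▸ hl i) (h0 i)
      simp [h, this]
    · field_simp
  obtain ⟨ν, v1, v2, v3, v4⟩ := exists_indep (p := fun i => if i = l then 1 else r i / q)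
    (by intro i; split_ifs; exacts [zero_le_one, div_nonneg (h0 i) hq0])
    (by intro i; split_ifs; exacts [le_rfl, div_le_one_of_le₀ (hl i) hq0])
  have hsum1 : ∀ i, i ≠ l →
      ∑ k ∈ Finset.univ.erase l, r k * (if i = k then (1 : ℝ) else 0) = r i := by
    intro i hi; simp [hi]
  have hsum0 : ∑ k ∈ Finset.univ.erase l, r k * (if l = k then (1 : ℝ) else 0) = 0 := by
    simp
  refine ⟨(1 - q) • ((∑ i ∈ Finset.univ.erase l, r i • dirac (unitv i)) +
    (1 - S) • dirac (fun _ => false)) + (q * (1 - q)) • dirac (unitv l) + (q * q) • ν,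
    ⟨?_, ?_, ?_, ?_⟩, ?_⟩
  · intro c
    have a1 : 0 ≤ 1 - q := by linarith
    have a2 : 0 ≤ 1 - S := by linarith
    have a3 := v1 c
    have a4 := dirac_nonneg (unitv l) c
    have a5 := dirac_nonneg (fun _ => false) c
    have a6 : 0 ≤ ∑ i ∈ Finset.univ.erase l, r i * dirac (unitv i) c :=
      Finset.sum_nonneg fun i _ => mul_nonneg (h0 i) (dirac_nonneg _ _)
    simp only [Pi.add_apply, Pi.smul_apply, smul_eq_mul, Finset.sum_apply]
    positivity
  · simp only [EE_add, EE_smul, EE_sum, EE_dirac, v2, mul_one, ← hSdef]; ring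
  · intro i
    simp only [EE_add, EE_smul, EE_sum, EE_dirac, v3, xx_unitv]
    have : xx i (fun _ => false) = 0 := by simp [xx]
    rw [this]
    by_cases hi : i = l
    · subst hi; rw [hsum0]; simp; linarith
    · rw [hsum1 i hi]; simp only [hi, if_false]
      linear_combination q * hdiv i
  · intro i j hij
    simp only [EE_add, EE_smul, EE_sum, EE_dirac, v4 i j hij, xx_unitv]
    have e0 : xx i (fun _ => false) = 0 := by simp [xx]
    have e1 : ∀ k, (if i = k then (1 : ℝ) else 0) * (if j = k then 1 else 0) = 0 := by
      intro k
      by_cases h : i = k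
      · subst h; simp [hij.symm]
      · simp [h]
    simp only [e0, e1]
    by_cases hi : i = l
    · have hj : j ≠ l := fun h => hij (hi.trans h.symm)
      simp only [hi, hj, if_true, if_false, ← hq]
      simp
      linear_combination q * hdiv j
    · by_cases hj : j = l
      · simp only [hi, hj, if_true, if_false, ← hq]
        simp
        linear_combination q * hdiv i
      · simp only [hi, hj, if_false]
        simp
        linear_combination (q * (r i / q)) * hdiv j + r j * hdiv i
  · simp only [EE_add, EE_smul, EE_sum, EE_dirac, nz_unitv, mul_one, ← hSdef]
    have e0 : nz (fun _ : Fin n => false) = 0 := by simp [nz]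
    have e1 : 1 ≤ EE ν nz := by
      have := v3 l
      simp only [if_true] at this
      rw [← this]
      refine EE_mono v1 fun c => ?_
      unfold xx nz
      by_cases h : c l = true
      · rw [if_pos h, if_pos ⟨l, h⟩]
      · rw [if_neg h]; split_ifs <;> norm_num
    rw [e0]
    nlinarith [mul_le_mul_of_nonneg_left e1 (mul_nonneg hq0 hq0)]

theorem upper {n : ℕ} {p : Fin n → ℝ} {θ} (h : PI2 n p θ) (l : Fin n) :
    EE θ nz ≤ p l + (1 - p l) * ∑ i ∈ Finset.univ.erase l, p i := by
  obtain ⟨h1, h2, h3, h4⟩ := h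
  have key : EE θ nz ≤ EE θ (fun c => xx l c + ∑ i ∈ Finset.univ.erase l,
      (xx i c - xx l c * xx i c)) := by
    refine EE_mono h1 fun c => ?_
    by_cases hl : c l = true
    · have : xx l c = 1 := by simp [xx, hl]
      simp only [this]
      simp
      unfold nz; split_ifs <;> norm_num
    · have : xx l c = 0 := by simp [xx, hl]
      simp only [this]
      have hx : ∀ i, 0 ≤ xx i c := by intro i; unfold xx; split_ifs <;> norm_num
      simp only [zero_mul, sub_zero, zero_add]
      by_cases hc : ∃ i, c i = true
      · obtain ⟨i, hi⟩ := hc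
        have hil : i ≠ l := by rintro rfl; exact hl hi
        have := Finset.single_le_sum (f := fun i => xx i c) (fun i _ => hx i)
          (Finset.mem_erase.2 ⟨hil, Finset.mem_univ i⟩)
        have e : xx i c = 1 := by simp [xx, hi]
        have e' : nz c = 1 := by unfold nz; rw [if_pos ⟨i, hi⟩]
        linarith
      · have e' : nz c = 0 := by unfold nz; rw [if_neg hc]
        rw [e']; exact Finset.sum_nonneg fun i _ => hx i
  refine key.trans (le_of_eq ?_)
  have : EE θ (fun c => xx l c + ∑ i ∈ Finset.univ.erase l, (xx i c - xx l c * xx i c)) =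
      EE θ (xx l) + ∑ i ∈ Finset.univ.erase l,
        (EE θ (xx i) - EE θ (fun c => xx l c * xx i c)) := by
    unfold EE
    simp only [mul_add, Finset.mul_sum, Finset.sum_add_distrib, mul_sub, Finset.sum_sub_distrib]
    rw [Finset.sum_comm]
    congr 2
    rw [Finset.sum_comm]
  rw [this, h3, Finset.mul_sum]
  congr 1
  refine Finset.sum_congr rfl fun i hi => ?_
  rw [h3, h4 l i (Finset.ne_of_mem_erase hi).symm]; ring

theorem upper_one {n : ℕ} {p : Fin n → ℝ} {θ} (h : PI2 n p θ) : EE θ nz ≤ 1 := by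
  rw [← h.2.1]
  refine EE_mono h.1 fun c => ?_
  unfold nz; split_ifs <;> norm_num

theorem lower {n : ℕ} {p : Fin n → ℝ} (l : Fin n) (h0 : ∀ i, 0 ≤ p i) (hl : ∀ i, p i ≤ p l)
    (h1 : p l ≤ 1) :
    ∃ θ, PI2 n p θ ∧
      min (p l + (1 - p l) * ∑ i ∈ Finset.univ.erase l, p i) 1 ≤ EE θ nz := by
  by_cases hS : ∑ i ∈ Finset.univ.erase l, p i ≤ 1
  · obtain ⟨θ, h, hle⟩ := base l h0 hl h1 hS
    exact ⟨θ, h, (min_le_left _ _).trans hle⟩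
  · push Not at hS
    set S := ∑ i ∈ Finset.univ.erase l, p i with hSd
    have hSpos : 0 < S := by linarith
    let r : Fin n → ℝ := fun i => if i = l then p l else p i / S
    have hrl : r l = p l := by simp [r]
    have hrp : ∀ i, r i ≤ p i := by
      intro i
      by_cases hi : i = l
      · subst hi; simp [r]
      · simp only [r, hi, if_false]; exact div_le_self (h0 i) hS.le
    have hsum : ∑ i ∈ Finset.univ.erase l, r i = 1 := by
      have : ∑ i ∈ Finset.univ.erase l, r i = ∑ i ∈ Finset.univ.erase l, p i / S :=
        Finset.sum_congr rfl fun i hi => by simp [r, Finset.ne_of_mem_erase hi]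
      rw [this, ← Finset.sum_div, ← hSd, div_self hSpos.ne']
    obtain ⟨θ, h, hle⟩ := base (r := r) l
      (by intro i; dsimp only [r]; split_ifs; exacts [h0 l, div_nonneg (h0 i) hSpos.le])
      (by intro i; rw [hrl]; exact (hrp i).trans (hl i)) (by rw [hrl]; exact h1) hsum.le
    obtain ⟨θ', h', hle'⟩ := noise h hrp (fun i => (hl i).trans h1)
    refine ⟨θ', h', (min_le_right _ _).trans (le_trans ?_ hle')⟩
    rw [hsum] at hle
    linarith

theorem stmt_3 (n : ℕ) (hn : 2 ≤ n) (p : Fin n → ℝ)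
    (hp0 : ∀ i, 0 ≤ p i) (hp1 : ∀ i, p i ≤ 1) (hmono : Monotone p) :
    IsGreatest {x : ℝ | ∃ θ : (Fin n → Bool) → ℝ, PairwiseIndep n p θ ∧ probGE n θ 1 = x}
      (min ((∑ i, p i) -
        p ⟨n - 1, by omega⟩ * ∑ i ∈ Finset.univ.erase (⟨n - 1, by omega⟩ : Fin n), p i) 1) := by
  have hlt : n - 1 < n := by omega
  have e : (∑ i, p i) - p ⟨n - 1, hlt⟩ * ∑ i ∈ Finset.univ.erase (⟨n - 1, hlt⟩ : Fin n), p i =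
      p ⟨n - 1, hlt⟩ +
        (1 - p ⟨n - 1, hlt⟩) * ∑ i ∈ Finset.univ.erase (⟨n - 1, hlt⟩ : Fin n), p i := by
    rw [← Finset.add_sum_erase _ p (Finset.mem_univ (⟨n - 1, hlt⟩ : Fin n))]; ring
  rw [e]
  have hup : ∀ θ, PI2 n p θ → EE θ nz ≤ min (p ⟨n - 1, hlt⟩ +
        (1 - p ⟨n - 1, hlt⟩) * ∑ i ∈ Finset.univ.erase (⟨n - 1, hlt⟩ : Fin n), p i) 1 :=
    fun θ h => le_min (upper h _) (upper_one h)
  constructor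
  · obtain ⟨θ, h, hle⟩ := lower (p := p) ⟨n - 1, hlt⟩ hp0
      (fun i => hmono (Fin.le_def.2 (by have := i.2; simp only; omega))) (hp1 _)
    exact ⟨θ, (PI2_iff p θ).2 h, by rw [probGE_eq]; exact le_antisymm (hup θ h) hle⟩
  · rintro x ⟨θ, h, rfl⟩
    rw [probGE_eq]
    exact hup θ ((PI2_iff p θ).1 h)
end
end

section
/- Let n ≥ 2, let p ∈ (0,1), and let k be an integer with 1 ≤ k ≤ n satisfying k ≥ 1 + (n−1)p. Then the minimum of P_θ(∑_{i=1}^n c_i ≥ k) over all pairwise independent distributions θ with all marginal probabilities equal to p equals ( 2 + (n−1)p − k )·p / ( n − k + 1 ) if k < 2 + (n−1)p, and equals 0 if k ≥ 2 + (n−1)p. -/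
open Finset

noncomputable section

/-- number of ones -/
def cnt {n : ℕ} (c : Fin n → Bool) : ℕ := (Finset.univ.filter (fun i => c i = true)).card

lemma cnt_le {n : ℕ} (c : Fin n → Bool) : cnt c ≤ n := by
  unfold cnt
  exact (Finset.card_filter_le _ _).trans (by simp)

lemma cnt_cast {n : ℕ} (c : Fin n → Bool) : (cnt c : ℝ) = ∑ i, if c i = true then (1:ℝ) else 0 := by
  unfold cnt
  rw [Finset.card_filter]; push_cast; rfl

lemma marg_eq (n : ℕ) (θ : (Fin n → Bool) → ℝ) (i : Fin n) :
    Marg n θ i = ∑ c, θ c * (if c i = true then (1:ℝ) else 0) := by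
  unfold Marg
  rw [Finset.sum_filter]
  exact Finset.sum_congr rfl fun c _ => by split_ifs <;> simp

lemma biv_eq (n : ℕ) (θ : (Fin n → Bool) → ℝ) (i j : Fin n) :
    Biv n θ i j = ∑ c, θ c * ((if c i = true then (1:ℝ) else 0) * (if c j = true then (1:ℝ) else 0)) := by
  unfold Biv
  rw [Finset.sum_filter]
  refine Finset.sum_congr rfl fun c _ => ?_
  by_cases h1 : c i = true <;> by_cases h2 : c j = true <;> simp [h1, h2]

lemma sum_marg (n : ℕ) (θ : (Fin n → Bool) → ℝ) :
    ∑ i, Marg n θ i = ∑ c, θ c * (cnt c : ℝ) := by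
  simp_rw [marg_eq, cnt_cast, Finset.mul_sum]
  rw [Finset.sum_comm]

lemma sum_biv (n : ℕ) (θ : (Fin n → Bool) → ℝ) :
    ∑ i, ∑ j, Biv n θ i j = ∑ c, θ c * (cnt c : ℝ) ^ 2 := by
  simp_rw [biv_eq, cnt_cast, sq, Finset.sum_mul_sum, Finset.mul_sum]
  rw [Finset.sum_comm]
  rw [Finset.sum_comm]
  conv_rhs => rw [Finset.sum_comm]
  refine Finset.sum_congr rfl fun i _ => ?_
  rw [Finset.sum_comm]

lemma biv_self (n : ℕ) (θ : (Fin n → Bool) → ℝ) (i : Fin n) : Biv n θ i i = Marg n θ i := by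
  simp [Biv, Marg]

lemma biv_comm (n : ℕ) (θ : (Fin n → Bool) → ℝ) (i j : Fin n) : Biv n θ i j = Biv n θ j i := by
  simp only [biv_eq]
  exact Finset.sum_congr rfl fun c _ => by ring

lemma sum_biv_const (n : ℕ) (θ : (Fin n → Bool) → ℝ) (a b : ℝ)
    (h1 : ∀ i, Marg n θ i = a) (h2 : ∀ i j, i ≠ j → Biv n θ i j = b) :
    ∑ c, θ c * (cnt c : ℝ) ^ 2 = n * a + n * (n - 1) * b := by
  rw [← sum_biv]
  have : ∀ i j, Biv n θ i j = b + if i = j then a - b else 0 := by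
    intro i j
    by_cases h : i = j
    · subst h; rw [biv_self, h1]; simp
    · rw [h2 i j h]; simp [h]
  simp_rw [this, Finset.sum_add_distrib]
  simp
  ring

lemma probGE_eq_s15 (n : ℕ) (θ : (Fin n → Bool) → ℝ) (k : ℕ) :
    probGE n θ k = ∑ c, θ c * (if k ≤ cnt c then (1:ℝ) else 0) := by
  unfold probGE
  rw [Finset.sum_filter]
  exact Finset.sum_congr rfl fun c _ => by unfold cnt; split_ifs <;> simp

lemma card_cnt (n t : ℕ) :
    (Finset.univ.filter (fun c : Fin n → Bool => cnt c = t)).card = n.choose t := by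
  have : (Finset.powersetCard t (Finset.univ : Finset (Fin n))).card = n.choose t := by simp
  rw [← this]
  refine Finset.card_bij' (fun c _ => Finset.univ.filter (fun i => c i = true))
    (fun s _ => fun i => decide (i ∈ s)) ?_ ?_ ?_ ?_
  · intro c hc
    rw [Finset.mem_filter] at hc
    simpa [Finset.mem_powersetCard, cnt] using hc.2
  · intro s hs
    rw [Finset.mem_filter]
    refine ⟨Finset.mem_univ _, ?_⟩
    simpa [Finset.mem_powersetCard, cnt] using hs
  · intro c hc; simp
  · intro s hs; simp

lemma cnt_perm {n : ℕ} (σ : Equiv.Perm (Fin n)) (c : Fin n → Bool) : cnt (c ∘ σ) = cnt c := by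
  have : (cnt (c ∘ σ) : ℝ) = cnt c := by
    rw [cnt_cast, cnt_cast]
    exact Equiv.sum_comp σ (fun i => if c i = true then (1:ℝ) else 0)
  exact_mod_cast this

lemma biv_perm (n : ℕ) (g : ℕ → ℝ) (σ : Equiv.Perm (Fin n)) (i j : Fin n) :
    Biv n (fun c => g (cnt c)) (σ i) (σ j) = Biv n (fun c => g (cnt c)) i j := by
  rw [biv_eq, biv_eq]
  refine Fintype.sum_equiv (Equiv.arrowCongr σ.symm (Equiv.refl Bool)) _ _ fun c => ?_
  have : (Equiv.arrowCongr σ.symm (Equiv.refl Bool)) c = c ∘ σ := by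
    ext x; simp [Equiv.arrowCongr]
  rw [this, cnt_perm]
  rfl

lemma biv_const (n : ℕ) (g : ℕ → ℝ) (i j i' j' : Fin n) (h : i ≠ j) (h' : i' ≠ j') :
    Biv n (fun c => g (cnt c)) i j = Biv n (fun c => g (cnt c)) i' j' := by
  have key : ∀ a b d : Fin n, a ≠ b → a ≠ d →
      Biv n (fun c => g (cnt c)) a b = Biv n (fun c => g (cnt c)) a d := by
    intro a b d hb hd
    have := biv_perm n g (Equiv.swap b d) a b
    rw [Equiv.swap_apply_of_ne_of_ne hb hd, Equiv.swap_apply_left] at this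
    exact this.symm
  by_cases hij : i = j'
  · subst hij
    rw [key i j i' h h'.symm, biv_comm]
  · rw [key i j j' h hij, biv_comm, key j' i i' (Ne.symm hij) h'.symm, biv_comm]

lemma marg_const (n : ℕ) (g : ℕ → ℝ) (i i' : Fin n) :
    Marg n (fun c => g (cnt c)) i = Marg n (fun c => g (cnt c)) i' := by
  rw [← biv_self, ← biv_self]
  have := biv_perm n g (Equiv.swap i i') i i
  rw [Equiv.swap_apply_left] at this
  exact this.symm

/-- point weights divided by binomials -/
def wt (n : ℕ) (b d : ℕ) (q0 q1 q2 : ℝ) (t : ℕ) : ℝ :=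
  (if t = 0 then q0 / (n.choose 0 : ℝ) else 0) + (if t = b then q1 / (n.choose b : ℝ) else 0)
    + (if t = d then q2 / (n.choose d : ℝ) else 0)

lemma sum_one (n t : ℕ) (ht : t ≤ n) (q : ℝ) (F : ℕ → ℝ) :
    ∑ c : Fin n → Bool, (if cnt c = t then q / (n.choose t : ℝ) else 0) * F (cnt c) = q * F t := by
  have h : ∀ c : Fin n → Bool, (if cnt c = t then q / (n.choose t : ℝ) else 0) * F (cnt c)
      = if cnt c = t then q / (n.choose t : ℝ) * F t else 0 := by
    intro c
    split_ifs with h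
    · rw [h]
    · simp
  simp_rw [h]
  rw [← Finset.sum_filter, Finset.sum_const, card_cnt, nsmul_eq_mul]
  have : (n.choose t : ℝ) ≠ 0 := by
    exact_mod_cast (Nat.choose_pos ht).ne'
  field_simp

lemma sum_wt (n b d : ℕ) (hb : b ≤ n) (hd : d ≤ n) (q0 q1 q2 : ℝ) (F : ℕ → ℝ) :
    ∑ c : Fin n → Bool, wt n b d q0 q1 q2 (cnt c) * F (cnt c) = q0 * F 0 + q1 * F b + q2 * F d := by
  simp only [wt, add_mul, Finset.sum_add_distrib]
  rw [sum_one n 0 (Nat.zero_le _), sum_one n b hb, sum_one n d hd]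

lemma exists_dist (n b d : ℕ) (hn : 2 ≤ n) (hb : b ≤ n) (hd : d ≤ n) (q0 q1 q2 p : ℝ)
    (h0 : 0 ≤ q0) (h1 : 0 ≤ q1) (h2 : 0 ≤ q2) (hs : q0 + q1 + q2 = 1)
    (hm : q1 * b + q2 * d = n * p) (hv : q1 * b ^ 2 + q2 * d ^ 2 = n * p + n * (n - 1) * p ^ 2)
    (k : ℕ) :
    ∃ θ : (Fin n → Bool) → ℝ, PairwiseIndep n (fun _ => p) θ ∧
      probGE n θ k = q0 * (if k ≤ 0 then 1 else 0) + q1 * (if k ≤ b then 1 else 0)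
        + q2 * (if k ≤ d then 1 else 0) := by
  have hn' : (2:ℝ) ≤ n := by exact_mod_cast hn
  have hM : ∀ i, Marg n (fun c => wt n b d q0 q1 q2 (cnt c)) i = p := by
    intro i
    have e := sum_marg n (fun c => wt n b d q0 q1 q2 (cnt c))
    rw [sum_wt n b d hb hd q0 q1 q2 (fun t => (t:ℝ)),
      Finset.sum_congr rfl (fun i' _ => marg_const n (wt n b d q0 q1 q2) i' i)] at e
    simp at e
    rw [hm] at e
    exact mul_left_cancel₀ (by positivity) e
  refine ⟨fun c => wt n b d q0 q1 q2 (cnt c), ⟨⟨?_, ?_⟩, hM, ?_⟩, ?_⟩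
  · intro c
    simp only [wt]
    have e1 : 0 ≤ q0 / (n.choose 0 : ℝ) := by positivity
    have e2 : 0 ≤ q1 / (n.choose b : ℝ) := by positivity
    have e3 : 0 ≤ q2 / (n.choose d : ℝ) := by positivity
    split_ifs <;> linarith
  · have := sum_wt n b d hb hd q0 q1 q2 (fun _ => 1)
    simp only [mul_one] at this
    rw [this, hs]
  · intro i j hij
    have e := sum_biv_const n (fun c => wt n b d q0 q1 q2 (cnt c)) p _ hM
      (fun i' j' h => biv_const n (wt n b d q0 q1 q2) i' j' i j h hij.ne)
    rw [sum_wt n b d hb hd q0 q1 q2 (fun t => (t:ℝ) ^ 2)] at e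
    simp only [Nat.cast_zero] at e
    have e' : ((n:ℝ) * (n - 1)) * Biv n (fun c => wt n b d q0 q1 q2 (cnt c)) i j
        = (n * (n - 1)) * (p * p) := by linarith
    exact mul_left_cancel₀ (mul_pos (by linarith) (by linarith)).ne' e'
  · rw [probGE_eq_s15]
    exact sum_wt n b d hb hd q0 q1 q2 (fun t => if k ≤ t then 1 else 0)

/-- three point distribution on 0, b, d -/
lemma exists_three (n b d : ℕ) (hn : 2 ≤ n) (hb : 1 ≤ b) (hbd : b < d) (hd : d ≤ n) (p : ℝ)
    (hp0 : 0 < p) (h1 : 1 + ((n:ℝ) - 1) * p ≤ d) (h2 : (b:ℝ) ≤ 1 + ((n:ℝ) - 1) * p)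
    (h0 : 0 ≤ (b:ℝ) * d - (b + d) * (n * p) + (n * p + n * (n - 1) * p ^ 2)) (k : ℕ) :
    ∃ θ : (Fin n → Bool) → ℝ, PairwiseIndep n (fun _ => p) θ ∧
      probGE n θ k = (1 - n * p * (d - 1 - (n - 1) * p) / (b * (d - b))
          - n * p * ((n - 1) * p - b + 1) / (d * (d - b))) * (if k ≤ 0 then 1 else 0)
        + (n * p * (d - 1 - (n - 1) * p) / (b * (d - b))) * (if k ≤ b then 1 else 0)
        + (n * p * ((n - 1) * p - b + 1) / (d * (d - b))) * (if k ≤ d then 1 else 0) := by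
  have hb' : (1:ℝ) ≤ b := by exact_mod_cast hb
  have hbd' : (0:ℝ) < d - b := by
    have : (b:ℝ) < d := by exact_mod_cast hbd
    linarith
  have hd' : (0:ℝ) < d := by linarith
  have hb0 : (0:ℝ) < b := by linarith
  refine exists_dist n b d hn (by omega) hd _ _ _ p ?_ ?_ ?_ ?_ ?_ ?_ k
  · have : 1 - n * p * (d - 1 - (n - 1) * p) / (b * (d - b))
          - n * p * ((n - 1) * p - b + 1) / (d * (d - b)) =
        ((b:ℝ) * d - (b + d) * (n * p) + (n * p + n * (n - 1) * p ^ 2)) / (b * d) := by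
      field_simp
      ring
    rw [this]
    positivity
  · exact div_nonneg (mul_nonneg (by positivity) (by linarith)) (by positivity)
  · exact div_nonneg (mul_nonneg (by positivity) (by linarith)) (by positivity)
  · ring
  · field_simp
    ring
  · field_simp
    ring

theorem stmt_15 (n k : ℕ) (hn : 2 ≤ n) (hk1 : 1 ≤ k) (hkn : k ≤ n)
    (p : ℝ) (hp0 : 0 < p) (hp1 : p < 1)
    (hk' : 1 + ((n : ℝ) - 1) * p ≤ (k : ℝ)) :
    ((k : ℝ) < 2 + ((n : ℝ) - 1) * p →
      IsLeast
        {x : ℝ | ∃ θ : (Fin n → Bool) → ℝ,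
          PairwiseIndep n (fun _ => p) θ ∧ probGE n θ k = x}
        ((2 + ((n : ℝ) - 1) * p - (k : ℝ)) * p / ((n : ℝ) - (k : ℝ) + 1))) ∧
    (2 + ((n : ℝ) - 1) * p ≤ (k : ℝ) →
      IsLeast
        {x : ℝ | ∃ θ : (Fin n → Bool) → ℝ,
          PairwiseIndep n (fun _ => p) θ ∧ probGE n θ k = x} 0) := by
  have hn' : (2:ℝ) ≤ n := by exact_mod_cast hn
  have hkn' : (k:ℝ) ≤ n := by exact_mod_cast hkn
  have hmp : 0 < ((n:ℝ) - 1) * p := mul_pos (by linarith) hp0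
  have hk2 : 2 ≤ k := by
    have : (1:ℝ) < k := by linarith
    have : 1 < k := by exact_mod_cast this
    omega
  have hk2' : (2:ℝ) ≤ k := by exact_mod_cast hk2
  refine ⟨fun hlt => ⟨?_, ?_⟩, fun hge => ⟨?_, ?_⟩⟩
  · have hc : ((k - 1 : ℕ) : ℝ) = (k:ℝ) - 1 := by
      rw [Nat.cast_sub hk1]; simp
    obtain ⟨θ, hθ, hP⟩ := exists_three n (k - 1) n hn (by omega) (by omega) le_rfl p hp0
      (by nlinarith) (by rw [hc]; linarith)
      (by
        rw [hc]
        have : 0 ≤ (n:ℝ) * ((1 - p) * (((k:ℝ) - 1) - (n - 1) * p)) :=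
          mul_nonneg (by linarith) (mul_nonneg (by linarith) (by linarith))
        nlinarith [this]) k
    refine ⟨θ, hθ, ?_⟩
    rw [hP, if_neg (by omega), if_neg (by omega), if_pos hkn, hc]
    have a1 : (n:ℝ) - (k - 1) ≠ 0 := by
      intro h; linarith
    have a2 : (n:ℝ) - k + 1 ≠ 0 := by
      intro h; linarith
    have a3 : (n:ℝ) ≠ 0 := by
      intro h; linarith
    field_simp
    ring
  · rintro x ⟨θ, ⟨⟨hpos, hsum⟩, hM, hB⟩, rfl⟩
    have hS := sum_marg n θ
    have hQ := sum_biv_const n θ p (p * p) hM (by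
      intro i j hij
      rcases lt_or_gt_of_ne hij with h | h
      · exact hB i j h
      · rw [biv_comm]; exact hB j i h)
    simp only [hM] at hS
    simp at hS
    have hD : (0:ℝ) < n * (n - k + 1) := mul_pos (by linarith) (by linarith)
    have hle : ∑ c, θ c * ((cnt c : ℝ) ^ 2 - (k - 1) * cnt c) ≤
        ∑ c, θ c * (if k ≤ cnt c then (1:ℝ) else 0) * (n * (n - k + 1)) := by
      refine Finset.sum_le_sum fun c _ => ?_
      rw [mul_assoc]
      refine mul_le_mul_of_nonneg_left ?_ (hpos c)
      have hc0 : (0:ℝ) ≤ cnt c := Nat.cast_nonneg _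
      have hcn : (cnt c : ℝ) ≤ n := by exact_mod_cast cnt_le c
      split_ifs with h
      · have : (k:ℝ) ≤ cnt c := by exact_mod_cast h
        nlinarith
      · have : (cnt c : ℝ) + 1 ≤ k := by exact_mod_cast (not_le.mp h)
        nlinarith
    rw [← Finset.sum_mul, ← probGE_eq_s15] at hle
    have hlhs : ∑ c, θ c * ((cnt c : ℝ) ^ 2 - (k - 1) * cnt c)
        = n * p + n * (n - 1) * (p * p) - (k - 1) * (n * p) := by
      rw [← hQ, hS, Finset.mul_sum, ← Finset.sum_sub_distrib]
      exact Finset.sum_congr rfl fun c _ => by ring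
    rw [hlhs] at hle
    rw [div_le_iff₀ (by linarith)]
    have hnn : (0:ℝ) < n := by linarith
    refine le_of_mul_le_mul_left ?_ hnn
    nlinarith [hle]
  · set j := ⌈((n:ℝ) - 1) * p⌉₊ with hj
    have hj1 : 1 ≤ j := Nat.one_le_iff_ne_zero.mpr (Nat.ceil_pos.mpr hmp).ne'
    have hjl : ((n:ℝ) - 1) * p ≤ j := Nat.le_ceil _
    have hju : (j:ℝ) < ((n:ℝ) - 1) * p + 1 := Nat.ceil_lt_add_one hmp.le
    have hjk : j + 2 ≤ k := by
      have : (j:ℝ) + 1 < k := by linarith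
      have : j + 1 < k := by exact_mod_cast this
      omega
    have hjn : (j:ℝ) + 2 ≤ n := by exact_mod_cast hjk.trans hkn
    obtain ⟨θ, hθ, hP⟩ := exists_three n j (j + 1) hn hj1 (by omega) (by omega) p hp0
      (by push_cast; linarith) (by linarith)
      (by
        push_cast
        have e1 : (0:ℝ) < (n:ℝ) - 1 := by linarith
        have e2 : 0 ≤ (n:ℝ) * (((n:ℝ) - 1) * p - j) ^ 2 + j * (n - 1 - j) :=
          add_nonneg (by positivity) (mul_nonneg (by positivity) (by linarith))
        refine nonneg_of_mul_nonneg_right (a := (n:ℝ) - 1) ?_ e1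
        calc (0:ℝ) ≤ _ := e2
          _ = _ := by ring) k
    refine ⟨θ, hθ, ?_⟩
    rw [hP, if_neg (by omega), if_neg (by omega), if_neg (by omega)]
    simp
  · rintro x ⟨θ, ⟨⟨hpos, hsum⟩, hM, hB⟩, rfl⟩
    exact Finset.sum_nonneg fun c _ => hpos c
end
end
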